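/- For every n ≥ 1, every alternating 2-form α on ℝⁿ satisfies |α|² ≤ ⌊n/2⌋·‖α‖², where |·| is the Euclidean norm and ‖·‖ is the comass; moreover, when n is even, equality is attained by the standard symplectic form Σᵢ e^{2i−1}∧e^{2i}. -/

import Mathlib

noncomputable section

open scoped BigOperators

/-- `ℝⁿ` with its standard Euclidean structure. -/
abbrev En (n : ℕ) : Type := EuclideanSpace ℝ (Fin n)

/-- The standard orthonormal basis of `ℝⁿ`. -/
def stdBn (n : ℕ) (i : Fin n) : En n := EuclideanSpace.single i 1

/-- Alternating 2-forms on `ℝⁿ`. -/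
abbrev Form2n (n : ℕ) : Type := AlternatingMap ℝ (En n) ℝ (Fin 2)

/-- The comass `‖α‖` of a 2-form: the sup of values on pairs of unit vectors. -/
def comass2 {n : ℕ} (α : Form2n n) : ℝ :=
  sSup {r : ℝ | ∃ v w : En n, ‖v‖ = 1 ∧ ‖w‖ = 1 ∧ α ![v, w] = r}

open scoped Classical in
/-- The square `|α|²` of the Euclidean norm of a 2-form:
`|α|² = Σ_{i<j} α(eᵢ, eⱼ)²`. -/
def eNormSq2 {n : ℕ} (α : Form2n n) : ℝ :=
  ∑ f ∈ Finset.univ.filter (fun f : Fin 2 → Fin n => StrictMono f),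
    (α (fun i => stdBn n (f i))) ^ 2

/-- The `j`-th coordinate functional `eʲ` on `ℝⁿ`. -/
def coordLn (n : ℕ) (j : Fin n) : En n →ₗ[ℝ] ℝ :=
  (LinearMap.proj j).comp (WithLp.linearEquiv 2 ℝ (Fin n → ℝ)).toLinearMap

/-- The decomposable 2-form `eᵃ∧eᵇ` on `ℝⁿ`. -/
def wedge2n (n : ℕ) (a b : Fin n) : Form2n n :=
  (Matrix.detRowAlternating : AlternatingMap ℝ (Fin 2 → ℝ) ℝ (Fin 2)).compLinearMap
    (LinearMap.pi (fun i : Fin 2 => coordLn n (![a, b] i)))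

/-- The standard symplectic form `Σᵢ e^{2i−1}∧e^{2i}` on `ℝ^{2m}`. -/
def stdSymplectic (m : ℕ) : Form2n (2 * m) :=
  ∑ i : Fin m,
    wedge2n (2 * m) ⟨2 * (i : ℕ), by have := i.2; omega⟩
      ⟨2 * (i : ℕ) + 1, by have := i.2; omega⟩

theorem Form2n.apply_swap {n : ℕ} (α : Form2n n) (v w : En n) : α ![w, v] = -α ![v, w] := by
  rw [← α.map_swap ![v, w] (show (0 : Fin 2) ≠ 1 by decide)]
  congr 1
  ext i
  fin_cases i <;> rfl

/-- A 2-form as a bilinear map. -/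
def Form2n.toBilin {n : ℕ} (α : Form2n n) : En n →ₗ[ℝ] En n →ₗ[ℝ] ℝ :=
  LinearMap.mk₂ ℝ (fun v w => α ![v, w])
    (fun v v' w => α.map_vecCons_add ![w] v v')
    (fun c v w => α.map_vecCons_smul ![w] c v)
    (fun v w w' => by
      simp only [α.apply_swap _ v, α.map_vecCons_add ![v] w w', neg_add])
    (fun c v w => by
      simp only [α.apply_swap _ v, α.map_vecCons_smul ![v] c w, smul_neg])

theorem Form2n.toBilin_apply {n : ℕ} (α : Form2n n) (v w : En n) :
    α.toBilin v w = α ![v, w] := rfl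

theorem sum_smul_stdBn {n : ℕ} (v : En n) : ∑ i, v i • stdBn n i = v := by
  ext j
  simp [stdBn, Pi.single_apply]

theorem Form2n.apply_eq_sum_right {n : ℕ} (α : Form2n n) (v w : En n) :
    α ![v, w] = ∑ j, w j * α ![v, stdBn n j] := by
  conv_lhs => rw [← α.toBilin_apply, ← sum_smul_stdBn w, map_sum]
  exact Finset.sum_congr rfl fun j _ => (α.toBilin v).map_smul _ _

theorem bddAbove_comass2 {n : ℕ} (α : Form2n n) :
    BddAbove {r : ℝ | ∃ v w : En n, ‖v‖ = 1 ∧ ‖w‖ = 1 ∧ α ![v, w] = r} := by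
  refine ⟨∑ j, ‖(α.toBilin.flip (stdBn n j)).toContinuousLinearMap‖, ?_⟩
  rintro _ ⟨v, w, hv, hw, rfl⟩
  rw [α.apply_eq_sum_right]
  refine Finset.sum_le_sum fun j _ => (le_abs_self _).trans ?_
  have hwj : |w j| ≤ 1 := hw ▸ PiLp.norm_apply_le w j
  have hvj : |α ![v, stdBn n j]| ≤ ‖(α.toBilin.flip (stdBn n j)).toContinuousLinearMap‖ := by
    simpa [hv, α.toBilin_apply] using (α.toBilin.flip (stdBn n j)).toContinuousLinearMap.le_opNorm v
  rw [abs_mul]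
  exact (mul_le_of_le_one_left (abs_nonneg _) hwj).trans hvj

theorem apply_le_comass2_mul {n : ℕ} (α : Form2n n) (v w : En n) :
    α ![v, w] ≤ comass2 α * (‖v‖ * ‖w‖) := by
  rcases eq_or_ne v 0 with rfl | hv
  · simp [← α.toBilin_apply]
  rcases eq_or_ne w 0 with rfl | hw
  · simp [← α.toBilin_apply]
  have hv' := norm_pos_iff.mpr hv
  have hw' := norm_pos_iff.mpr hw
  have h : α ![‖v‖⁻¹ • v, ‖w‖⁻¹ • w] ≤ comass2 α :=
    le_csSup (bddAbove_comass2 α)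
      ⟨_, _, norm_smul_inv_norm hv, norm_smul_inv_norm hw, rfl⟩
  rw [← α.toBilin_apply, map_smul, map_smul, LinearMap.smul_apply, α.toBilin_apply,
    smul_eq_mul, smul_eq_mul, ← mul_assoc, ← mul_inv, inv_mul_le_iff₀ (by positivity)] at h
  linarith

theorem two_mul_eNormSq2 {n : ℕ} (α : Form2n n) :
    2 * eNormSq2 α = ∑ i, ∑ j, α ![stdBn n i, stdBn n j] ^ 2 := by
  classical
  have hlt : eNormSq2 α =
      ∑ i, ∑ j, if i < j then α ![stdBn n i, stdBn n j] ^ 2 else 0 := by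
    unfold eNormSq2
    rw [Finset.sum_filter, ← Fintype.sum_prod_type',
      ← (finTwoArrowEquiv (Fin n)).symm.sum_comp]
    refine Finset.sum_congr rfl fun p _ => ?_
    have h : (fun i => stdBn n ((finTwoArrowEquiv (Fin n)).symm p i)) =
        ![stdBn n p.1, stdBn n p.2] := by
      ext i : 1
      fin_cases i <;> rfl
    have hp : StrictMono ((finTwoArrowEquiv (Fin n)).symm p) ↔ p.1 < p.2 := by
      simp [Fin.strictMono_iff_lt_succ, finTwoArrowEquiv]
    simp only [h, hp]
  have hgt : eNormSq2 α =
      ∑ i, ∑ j, if j < i then α ![stdBn n i, stdBn n j] ^ 2 else 0 := by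
    rw [hlt, Finset.sum_comm]
    refine Finset.sum_congr rfl fun i _ => Finset.sum_congr rfl fun j _ => ?_
    rw [α.apply_swap, neg_sq]
  rw [two_mul]
  nth_rewrite 1 [hlt]
  rw [hgt, ← Finset.sum_add_distrib]
  refine Finset.sum_congr rfl fun i _ => ?_
  rw [← Finset.sum_add_distrib]
  refine Finset.sum_congr rfl fun j _ => ?_
  rcases lt_trichotomy i j with h | rfl | h
  · simp [h, h.not_gt]
  · have := α.apply_swap (stdBn n i) (stdBn n i)
    simp [show α ![stdBn n i, stdBn n i] = 0 by linarith]
  · simp [h, h.not_gt]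

/-- The contraction of `α` with `v` has norm at most the comass times the norm of any vector `x`
having the same contraction. -/
theorem sum_sq_apply_le {n : ℕ} (α : Form2n n) (v x : En n)
    (hx : ∀ w, α ![v, w] = α ![x, w]) :
    ∑ j, α ![v, stdBn n j] ^ 2 ≤ comass2 α ^ 2 * ‖x‖ ^ 2 := by
  set w : En n := WithLp.toLp 2 fun j => α ![v, stdBn n j] with hw
  have hsum : ∑ j, α ![v, stdBn n j] ^ 2 = ‖w‖ ^ 2 := by
    simp [EuclideanSpace.norm_sq_eq, hw]
  have happ : α ![v, w] = ‖w‖ ^ 2 := by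
    rw [α.apply_eq_sum_right, ← hsum]
    exact Finset.sum_congr rfl fun j _ => (sq _).symm
  have hle : ‖w‖ ^ 2 ≤ comass2 α * (‖x‖ * ‖w‖) := by
    rw [← happ, hx]
    exact apply_le_comass2_mul α x w
  rw [hsum, ← mul_pow]
  rcases (norm_nonneg w).eq_or_lt with h0 | hpos
  · rw [← h0, zero_pow two_ne_zero]
    positivity
  · exact pow_le_pow_left₀ hpos.le (le_of_mul_le_mul_right (by linarith) hpos) 2

theorem two_mul_eNormSq2_le {n : ℕ} (α : Form2n n) :
    2 * eNormSq2 α ≤ n * comass2 α ^ 2 := by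
  rw [two_mul_eNormSq2]
  calc _ ≤ ∑ _i : Fin n, comass2 α ^ 2 := Finset.sum_le_sum fun i _ => by
        simpa [stdBn] using sum_sq_apply_le α (stdBn n i) (stdBn n i) fun _ => rfl
    _ = _ := by simp

theorem two_mul_eNormSq2_le_of_kernel {n : ℕ} (α : Form2n n) (u : En n) (hu : ‖u‖ = 1)
    (hker : ∀ w, α ![u, w] = 0) :
    2 * eNormSq2 α ≤ (n - 1) * comass2 α ^ 2 := by
  have hrow (i : Fin n) :
      ∑ j, α ![stdBn n i, stdBn n j] ^ 2 ≤ comass2 α ^ 2 * (1 - u i ^ 2) := by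
    refine (sum_sq_apply_le α (stdBn n i) (stdBn n i - u i • u) fun w => ?_).trans_eq ?_
    · simp only [← α.toBilin_apply] at hker ⊢
      simp [hker]
    · rw [norm_sub_sq_real, norm_smul, hu, real_inner_smul_right]
      simp [stdBn, EuclideanSpace.inner_single_left]
      left
      ring
  have hsq : ∑ i, u i ^ 2 = 1 := by
    simpa [hu] using (EuclideanSpace.norm_sq_eq u).symm
  rw [two_mul_eNormSq2]
  refine (Finset.sum_le_sum fun i _ => hrow i).trans_eq ?_
  rw [← Finset.mul_sum, Finset.sum_sub_distrib, hsq]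
  simp [mul_comm]

theorem Form2n.exists_unit_kernel {n : ℕ} (hn : Odd n) (α : Form2n n) :
    ∃ u : En n, ‖u‖ = 1 ∧ ∀ w, α ![u, w] = 0 := by
  let M : Matrix (Fin n) (Fin n) ℝ := Matrix.of fun i j => α ![stdBn n i, stdBn n j]
  have hskew : M.transpose = -M := by
    ext i j
    exact α.apply_swap _ _
  have hdet : M.det = 0 := by
    have h := M.det_transpose
    rw [hskew, Matrix.det_neg, Fintype.card_fin, hn.neg_one_pow] at h
    linarith
  obtain ⟨x, hx0, hx⟩ := Matrix.exists_mulVec_eq_zero_iff.mpr hdet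
  have hx' (i : Fin n) : α ![stdBn n i, WithLp.toLp 2 x] = 0 := by
    rw [α.apply_eq_sum_right, ← show (M.mulVec x) i = 0 from congrFun hx i]
    exact Finset.sum_congr rfl fun j _ => mul_comm _ _
  have hne : (WithLp.toLp 2 x : En n) ≠ 0 := by simpa using hx0
  refine ⟨_, norm_smul_inv_norm (𝕜 := ℝ) hne, fun w => ?_⟩
  rw [α.apply_eq_sum_right]
  refine Finset.sum_eq_zero fun j _ => ?_
  rw [α.apply_swap, ← α.toBilin_apply, map_smul, α.toBilin_apply, hx']
  simp

theorem eNormSq2_le {n : ℕ} (α : Form2n n) :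
    eNormSq2 α ≤ ((n / 2 : ℕ) : ℝ) * comass2 α ^ 2 := by
  rcases n.even_or_odd' with ⟨k, rfl | rfl⟩
  · have h := two_mul_eNormSq2_le α
    rw [Nat.mul_div_cancel_left k two_pos]
    push_cast at h
    linarith
  · obtain ⟨u, hu, hker⟩ := Form2n.exists_unit_kernel ⟨k, rfl⟩ α
    have h := two_mul_eNormSq2_le_of_kernel α u hu hker
    rw [show (2 * k + 1) / 2 = k by omega]
    push_cast at h
    linarith

theorem sum_fin_two_mul {m : ℕ} (f : Fin (2 * m) → ℝ) :
    ∑ k, f k = ∑ i : Fin m, (f ⟨2 * (i : ℕ), by omega⟩ + f ⟨2 * (i : ℕ) + 1, by omega⟩) := by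
  induction m with
  | zero => simp
  | succ m ih =>
    rw [Fin.sum_univ_castSucc (n := m)]
    refine (Fin.sum_univ_castSucc (n := 2 * m + 1) f).trans ?_
    rw [Fin.sum_univ_castSucc, add_assoc]
    congr 1
    exact ih fun k => f k.castSucc.castSucc

theorem stdSymplectic_apply {m : ℕ} (v w : En (2 * m)) :
    stdSymplectic m ![v, w] = ∑ i : Fin m,
      (v ⟨2 * (i : ℕ), by omega⟩ * w ⟨2 * (i : ℕ) + 1, by omega⟩ -
        v ⟨2 * (i : ℕ) + 1, by omega⟩ * w ⟨2 * (i : ℕ), by omega⟩) := by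
  let ev : Form2n (2 * m) →+ ℝ :=
    { toFun := fun α => α ![v, w], map_zero' := rfl, map_add' := fun _ _ => rfl }
  refine (map_sum ev _ _).trans (Finset.sum_congr rfl fun i _ => ?_)
  exact Matrix.det_fin_two _

theorem stdSymplectic_apply_stdBn_even {m : ℕ} (v : En (2 * m)) (k : Fin m) :
    stdSymplectic m ![v, stdBn (2 * m) ⟨2 * (k : ℕ), by omega⟩] =
      -v ⟨2 * (k : ℕ) + 1, by omega⟩ := by
  rw [stdSymplectic_apply, Finset.sum_eq_single k]
  · simp [stdBn]
  · intro i _ hi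
    have h1 : 2 * (i : ℕ) + 1 ≠ 2 * (k : ℕ) := by omega
    have h2 : (i : ℕ) ≠ k := Fin.val_ne_of_ne hi
    simp [stdBn, h1, h2]
  · simp

theorem stdSymplectic_apply_stdBn_odd {m : ℕ} (v : En (2 * m)) (k : Fin m) :
    stdSymplectic m ![v, stdBn (2 * m) ⟨2 * (k : ℕ) + 1, by omega⟩] =
      v ⟨2 * (k : ℕ), by omega⟩ := by
  have h1 (i : Fin m) : 2 * (i : ℕ) ≠ 2 * (k : ℕ) + 1 := by omega
  rw [stdSymplectic_apply, Finset.sum_eq_single k]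
  · simp [stdBn]
  · intro i _ hi
    have h2 : (i : ℕ) ≠ k := Fin.val_ne_of_ne hi
    simp [stdBn, h1, h2]
  · simp

theorem eNormSq2_stdSymplectic (m : ℕ) : eNormSq2 (stdSymplectic m) = m := by
  have h := two_mul_eNormSq2 (stdSymplectic m)
  have hone (k : Fin (2 * m)) : ∑ i, (stdBn (2 * m) i k) ^ 2 = 1 := by
    simp [stdBn]
  rw [Finset.sum_comm, sum_fin_two_mul] at h
  simp only [stdSymplectic_apply_stdBn_even, stdSymplectic_apply_stdBn_odd, neg_sq, hone] at h
  simp at h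
  linarith

theorem comass2_stdSymplectic {m : ℕ} (hm : 1 ≤ m) : comass2 (stdSymplectic m) = 1 := by
  refine IsGreatest.csSup_eq ⟨?_, ?_⟩
  · refine ⟨stdBn (2 * m) ⟨0, by omega⟩, stdBn (2 * m) ⟨1, by omega⟩, ?_, ?_, ?_⟩
    · simp [stdBn]
    · simp [stdBn]
    · refine (stdSymplectic_apply_stdBn_odd _ (⟨0, hm⟩ : Fin m)).trans ?_
      simp [stdBn]
  · rintro _ ⟨v, w, hv, hw, rfl⟩
    have hv2 := EuclideanSpace.norm_sq_eq v
    have hw2 := EuclideanSpace.norm_sq_eq w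
    simp only [hv, hw, Real.norm_eq_abs, sq_abs, one_pow] at hv2 hw2
    rw [sum_fin_two_mul] at hv2 hw2
    calc _ ≤ ∑ i : Fin m, ((v ⟨2 * (i : ℕ), by omega⟩ ^ 2 + v ⟨2 * (i : ℕ) + 1, by omega⟩ ^ 2) +
          (w ⟨2 * (i : ℕ), by omega⟩ ^ 2 + w ⟨2 * (i : ℕ) + 1, by omega⟩ ^ 2)) / 2 := by
          rw [stdSymplectic_apply]
          refine Finset.sum_le_sum fun i _ => ?_
          nlinarith [sq_nonneg (v ⟨2 * (i : ℕ), by omega⟩ - w ⟨2 * (i : ℕ) + 1, by omega⟩),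
            sq_nonneg (v ⟨2 * (i : ℕ) + 1, by omega⟩ + w ⟨2 * (i : ℕ), by omega⟩)]
      _ = 1 := by
          rw [← Finset.sum_div, Finset.sum_add_distrib, ← hv2, ← hw2]
          norm_num

/-- For every `n ≥ 1`, every 2-form `α` on `ℝⁿ` satisfies `|α|² ≤ ⌊n/2⌋·‖α‖²`; moreover, for
even `n = 2m` (`m ≥ 1`) equality is attained by the standard symplectic form. -/
theorem two_form_wirtinger :
    (∀ (n : ℕ), 1 ≤ n → ∀ α : Form2n n,
      eNormSq2 α ≤ ((n / 2 : ℕ) : ℝ) * comass2 α ^ 2) ∧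
    (∀ m : ℕ, 1 ≤ m →
      eNormSq2 (stdSymplectic m) =
        ((2 * m / 2 : ℕ) : ℝ) * comass2 (stdSymplectic m) ^ 2) := by
  refine ⟨fun n _ α => eNormSq2_le α, fun m hm => ?_⟩
  rw [eNormSq2_stdSymplectic, comass2_stdSymplectic hm, Nat.mul_div_cancel_left m two_pos]
  simp
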